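/- arXiv:math/0011009 — 2 statements merged into one kernel-verified Lean document; each statement's English description precedes it below -/
import Mathlib

section
/- Let x ∈ 𝒪ₙ satisfy ω_t(x) = t^k x for all t ∈ 𝕋, where k ≠ 0 and ω is the gauge action on the Cuntz algebra 𝒪ₙ (n ≥ 2). If x is normal (x x* = x* x), then x = 0. -/
namespace CuntzAux
open Filter Topology

noncomputable section

/-- product of the generators along a word of length `p`. -/
def wd {O : Type*} [CStarAlgebra O] {n : ℕ} (s : Fin n → O) : (p : ℕ) → (Fin p → Fin n) → O
  | 0, _ => 1
  | p + 1, μ => wd s p (Fin.init μ) * s (μ (Fin.last p))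

/-- `z` is a combination of `s_μ s_ν*` with `|μ| = p`, `|ν| = q`. -/
def V {O : Type*} [CStarAlgebra O] {n : ℕ} (s : Fin n → O) (p q : ℕ) (z : O) : Prop :=
  ∀ (μ : Fin p → Fin n) (ν : Fin q → Fin n), ∃ c : ℂ,
    star (wd s p μ) * z * wd s q ν = algebraMap ℂ O c

/-- The unnormalised trace. -/
def T {O : Type*} [CStarAlgebra O] {n : ℕ} (s : Fin n → O) (p : ℕ) : O →ₗ[ℂ] O where
  toFun b := ∑ μ : Fin p → Fin n, star (wd s p μ) * b * wd s p μ
  map_add' a b := by simp [mul_add, add_mul, Finset.sum_add_distrib]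
  map_smul' c b := by simp [Finset.smul_sum]

/-- The normalised trace. -/
def tr {O : Type*} [CStarAlgebra O] {n : ℕ} (s : Fin n → O) (p : ℕ) : O →ₗ[ℂ] O :=
  ((n : ℂ) ^ p)⁻¹ • T s p

variable {O : Type*} [CStarAlgebra O] {n : ℕ} {s : Fin n → O}

lemma T_apply (p : ℕ) (b : O) :
    T s p b = ∑ μ : Fin p → Fin n, star (wd s p μ) * b * wd s p μ := rfl

lemma tr_apply (p : ℕ) (b : O) : tr s p b = ((n : ℂ) ^ p)⁻¹ • T s p b := rfl

lemma sum_succ {M : Type*} [AddCommMonoid M] (p : ℕ) (f : (Fin p → Fin n) → Fin n → M) :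
    ∑ μ : Fin (p + 1) → Fin n, f (Fin.init μ) (μ (Fin.last p)) =
      ∑ i, ∑ μ : Fin p → Fin n, f μ i := by
  rw [← Fintype.sum_prod_type', ← Equiv.sum_comp (Fin.snocEquiv (fun _ : Fin (p + 1) => Fin n))]
  refine Finset.sum_congr rfl fun x _ => ?_
  simp [Fin.snocEquiv]

lemma wd_star_self (hiso : ∀ i j : Fin n, star (s i) * s j = if i = j then (1 : O) else 0)
    (p : ℕ) (μ : Fin p → Fin n) : star (wd s p μ) * wd s p μ = 1 := by
  induction p with
  | zero => simp [wd]
  | succ p ih =>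
    simp only [wd, star_mul]
    rw [mul_assoc, ← mul_assoc (star (wd s p _)), ih, one_mul, hiso]; simp

lemma wd_sum (hsum : ∑ i : Fin n, s i * star (s i) = (1 : O)) (p : ℕ) :
    ∑ μ : Fin p → Fin n, wd s p μ * star (wd s p μ) = 1 := by
  induction p with
  | zero => simp [wd]
  | succ p ih =>
    simp only [wd, star_mul]
    rw [sum_succ p (fun μ i => wd s p μ * s i * (star (s i) * star (wd s p μ))), Finset.sum_comm,
      ← ih]
    refine Finset.sum_congr rfl fun μ _ => ?_
    have : ∀ i, wd s p μ * s i * (star (s i) * star (wd s p μ))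
      = wd s p μ * (s i * star (s i)) * star (wd s p μ) := fun i => by simp only [mul_assoc]
    simp only [this]
    rw [← Finset.sum_mul, ← Finset.mul_sum, hsum, mul_one]

lemma norm_wd_le (hiso : ∀ i j : Fin n, star (s i) * s j = if i = j then (1 : O) else 0)
    (p : ℕ) (μ : Fin p → Fin n) : ‖wd s p μ‖ ≤ 1 := by
  nontriviality O
  have := CStarRing.norm_star_mul_self (x := wd s p μ)
  rw [wd_star_self hiso, norm_one] at this
  nlinarith [norm_nonneg (wd s p μ)]

lemma V_succ (hiso : ∀ i j : Fin n, star (s i) * s j = if i = j then (1 : O) else 0)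
    {p q : ℕ} {z : O} (h : V s p q z) : V s (p + 1) (q + 1) z := by
  intro μ ν
  obtain ⟨c, hc⟩ := h (Fin.init μ) (Fin.init ν)
  refine ⟨if μ (Fin.last p) = ν (Fin.last q) then c else 0, ?_⟩
  have : star (wd s (p + 1) μ) * z * wd s (q + 1) ν = star (s (μ (Fin.last p))) *
      (star (wd s p (Fin.init μ)) * z * wd s q (Fin.init ν)) * s (ν (Fin.last q)) := by
    simp only [wd, star_mul, mul_assoc]
  rw [this, hc, ← Algebra.commutes, mul_assoc, hiso]
  split_ifs <;> simp

lemma V_add (hiso : ∀ i j : Fin n, star (s i) * s j = if i = j then (1 : O) else 0)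
    {p q : ℕ} {z : O} (h : V s p q z) (m : ℕ) : V s (p + m) (q + m) z := by
  induction m with
  | zero => exact h
  | succ m ih => exact V_succ hiso ih

lemma V.add {p q : ℕ} {z w : O} (h : V s p q z) (h' : V s p q w) : V s p q (z + w) := by
  intro μ ν
  obtain ⟨c, hc⟩ := h μ ν
  obtain ⟨d, hd⟩ := h' μ ν
  exact ⟨c + d, by rw [mul_add, add_mul, hc, hd, map_add]⟩

lemma V.adj {p q : ℕ} {z : O} (h : V s p q z) : V s q p (star z) := by
  intro μ ν
  obtain ⟨c, hc⟩ := h ν μ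
  refine ⟨star c, ?_⟩
  rw [algebraMap_star_comm, ← hc]
  simp [mul_assoc]

lemma V.mul (hsum : ∑ i : Fin n, s i * star (s i) = (1 : O))
    {p q r : ℕ} {z w : O} (h : V s p q z) (h' : V s q r w) : V s p r (z * w) := by
  intro μ ν
  choose c hc using h
  choose d hd using h'
  refine ⟨∑ l, c μ l * d l ν, ?_⟩
  rw [map_sum]
  simp only [map_mul, ← hc, ← hd]
  have e : z * w = z * (∑ l : Fin q → Fin n, wd s q l * star (wd s q l)) * w := by
    rw [wd_sum hsum q, mul_one]
  rw [e]
  simp only [Finset.mul_sum, Finset.sum_mul, mul_assoc]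

lemma V_algebraMap (c : ℂ) : V s 0 0 (algebraMap ℂ O c) := by
  intro μ ν
  exact ⟨c, by simp [wd]⟩

lemma V_gen (hiso : ∀ i j : Fin n, star (s i) * s j = if i = j then (1 : O) else 0) (i : Fin n) :
    V s 1 0 (s i) := by
  intro μ ν
  refine ⟨if μ 0 = i then 1 else 0, ?_⟩
  simp only [wd, one_mul, mul_one]
  rw [show Fin.last 0 = 0 from rfl, hiso]
  split_ifs <;> simp

lemma V_pow (hiso : ∀ i j : Fin n, star (s i) * s j = if i = j then (1 : O) else 0)
    (hsum : ∑ i : Fin n, s i * star (s i) = (1 : O))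
    {p : ℕ} {z : O} (h : V s p p z) (m : ℕ) : V s p p (z ^ m) := by
  induction m with
  | zero =>
    rw [pow_zero]
    have := V_add hiso (V_algebraMap (s := s) 1) p
    simpa using this
  | succ m ih => rw [pow_succ]; exact ih.mul hsum h

/-! Gauge action -/

lemma omega_wd (ω : Circle → O ≃⋆ₐ[ℂ] O)
    (hgauge : ∀ (t : Circle) (i : Fin n), ω t (s i) = (t : ℂ) • s i) (t : Circle) (p : ℕ)
    (μ : Fin p → Fin n) : ω t (wd s p μ) = ((t : ℂ) ^ p) • wd s p μ := by
  induction p with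
  | zero => simp [wd]
  | succ p ih =>
    simp only [wd, map_mul, ih, hgauge, pow_succ]
    rw [smul_mul_smul_comm]

lemma star_zpow_circle (t : Circle) (k : ℤ) : star ((t : ℂ) ^ k) = (t : ℂ) ^ (-k) := by
  rw [star_zpow₀, zpow_neg, ← inv_zpow, ← Circle.coe_inv, Circle.coe_inv_eq_conj]; rfl

lemma V_expand (hsum : ∑ i : Fin n, s i * star (s i) = (1 : O)) (p q : ℕ) (z : O) :
    z = ∑ μ : Fin p → Fin n, ∑ ν : Fin q → Fin n,
      wd s p μ * (star (wd s p μ) * z * wd s q ν) * star (wd s q ν) := by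
  have h : z = (∑ μ : Fin p → Fin n, wd s p μ * star (wd s p μ)) * z *
      ∑ ν : Fin q → Fin n, wd s q ν * star (wd s q ν) := by
    rw [wd_sum hsum p, wd_sum hsum q, one_mul, mul_one]
  conv_lhs => rw [h]
  simp only [Finset.mul_sum, Finset.sum_mul, mul_assoc]
  exact Finset.sum_comm

lemma V_omega (hsum : ∑ i : Fin n, s i * star (s i) = (1 : O))
    (ω : Circle → O ≃⋆ₐ[ℂ] O)
    (hgauge : ∀ (t : Circle) (i : Fin n), ω t (s i) = (t : ℂ) • s i) (t : Circle)
    {p q : ℕ} {z : O} (h : V s p q z) : ω t z = ((t : ℂ) ^ ((p : ℤ) - q)) • z := by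
  choose c hc using h
  have e := V_expand hsum p q z
  simp only [hc] at e
  rw [e]
  simp only [map_sum, map_mul, map_star, Finset.smul_sum, omega_wd ω hgauge]
  refine Finset.sum_congr rfl fun μ _ => Finset.sum_congr rfl fun ν _ => ?_
  have h1 : ω t (algebraMap ℂ O (c μ ν)) = algebraMap ℂ O (c μ ν) := by
    simp [Algebra.algebraMap_eq_smul_one]
  have h2 : star ((t : ℂ) ^ q) = (t : ℂ) ^ (-(q : ℤ)) := by
    rw [← star_zpow_circle]; simp
  rw [h1, star_smul, h2, smul_mul_assoc, smul_mul_smul_comm, sub_eq_add_neg,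
    zpow_add₀ (Circle.coe_ne_zero t), zpow_natCast]

/-- homogeneous elements of grade `j`. -/
def A {O : Type*} [CStarAlgebra O] {n : ℕ} (s : Fin n → O) (j : ℤ) (z : O) : Prop :=
  ∃ p q : ℕ, (p : ℤ) - q = j ∧ V s p q z

lemma V_congr {p q p' q' : ℕ} {z : O} (h : V s p q z) (hp : p = p') (hq : q = q') :
    V s p' q' z := by subst hp hq; exact h

lemma A.add (hiso : ∀ i j : Fin n, star (s i) * s j = if i = j then (1 : O) else 0)
    {j : ℤ} {z w : O} (h : A s j z) (h' : A s j w) : A s j (z + w) := by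
  obtain ⟨p, q, e, h⟩ := h
  obtain ⟨p', q', e', h'⟩ := h'
  refine ⟨p + p', q + p', by push_cast; omega, ?_⟩
  exact (V_add hiso h p').add (V_congr (V_add hiso h' p) (by omega) (by omega))

lemma A.mul (hiso : ∀ i j : Fin n, star (s i) * s j = if i = j then (1 : O) else 0)
    (hsum : ∑ i : Fin n, s i * star (s i) = (1 : O))
    {i j : ℤ} {z w : O} (h : A s i z) (h' : A s j w) : A s (i + j) (z * w) := by
  obtain ⟨p, q, e, h⟩ := h
  obtain ⟨p', q', e', h'⟩ := h'
  refine ⟨p + p', q' + q, by push_cast; omega, ?_⟩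
  exact (V_add hiso h p').mul hsum (V_congr (V_add hiso h' q) (by omega) (by omega))

lemma A.adj {i : ℤ} {z : O} (h : A s i z) : A s (-i) (star z) := by
  obtain ⟨p, q, e, h⟩ := h
  exact ⟨q, p, by omega, h.adj⟩

lemma adjoin_span (hiso : ∀ i j : Fin n, star (s i) * s j = if i = j then (1 : O) else 0)
    (hsum : ∑ i : Fin n, s i * star (s i) = (1 : O)) {b : O}
    (hb : b ∈ StarAlgebra.adjoin ℂ (Set.range s)) :
    b ∈ AddSubmonoid.closure {z : O | ∃ j, A s j z} := by
  induction hb using StarAlgebra.adjoin_induction with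
  | mem x h =>
    obtain ⟨i, rfl⟩ := h
    exact AddSubmonoid.subset_closure ⟨1, 1, 0, by simp, V_gen hiso i⟩
  | algebraMap r => exact AddSubmonoid.subset_closure ⟨0, 0, 0, by simp, V_algebraMap r⟩
  | add x y hx hy h1 h2 => exact add_mem h1 h2
  | mul x y hx hy h1 h2 =>
    clear hx hy
    induction h1 using AddSubmonoid.closure_induction with
    | mem x hx =>
      induction h2 using AddSubmonoid.closure_induction with
      | mem y hy =>
        obtain ⟨i, hx⟩ := hx
        obtain ⟨j, hy⟩ := hy
        exact AddSubmonoid.subset_closure ⟨_, hx.mul hiso hsum hy⟩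
      | zero => simp
      | add a b _ _ h1 h2 => rw [mul_add]; exact add_mem h1 h2
    | zero => simp
    | add a b _ _ h1 h2 => rw [add_mul]; exact add_mem h1 h2
  | star x hx h =>
    clear hx
    induction h using AddSubmonoid.closure_induction with
    | mem x hx => obtain ⟨i, hx⟩ := hx; exact AddSubmonoid.subset_closure ⟨_, hx.adj⟩
    | zero => simp
    | add a b _ _ h1 h2 => rw [star_add]; exact add_mem h1 h2

/-- Discrete Fourier coefficient. -/
def E (ω : Circle → O ≃⋆ₐ[ℂ] O) (k : ℤ) (N : ℕ) (b : O) : O :=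
  (N : ℂ)⁻¹ • ∑ l ∈ Finset.range N, (((Circle.exp (2 * Real.pi / N)) ^ l : Circle) : ℂ) ^ (-k) •
    ω ((Circle.exp (2 * Real.pi / N)) ^ l) b

lemma E_add (ω : Circle → O ≃⋆ₐ[ℂ] O) (k : ℤ) (N : ℕ) (a b : O) :
    E ω k N (a + b) = E ω k N a + E ω k N b := by
  simp [E, Finset.sum_add_distrib]

lemma E_sub (ω : Circle → O ≃⋆ₐ[ℂ] O) (k : ℤ) (N : ℕ) (a b : O) :
    E ω k N (a - b) = E ω k N a - E ω k N b := by
  simp [E, Finset.sum_sub_distrib, smul_sub]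

lemma E_norm (ω : Circle → O ≃⋆ₐ[ℂ] O) (k : ℤ) (N : ℕ) (b : O) : ‖E ω k N b‖ ≤ ‖b‖ := by
  rw [E, norm_smul]
  have h : ‖∑ l ∈ Finset.range N, (((Circle.exp (2 * Real.pi / N)) ^ l : Circle) : ℂ) ^ (-k) •
    ω ((Circle.exp (2 * Real.pi / N)) ^ l) b‖ ≤ ∑ l ∈ Finset.range N, ‖b‖ := by
    refine norm_sum_le_of_le _ fun l _ => ?_
    rw [norm_smul, norm_zpow, Circle.norm_coe, one_zpow, one_mul]
    exact (StarAlgEquiv.norm_map (ω _) b).le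
  rw [Finset.sum_const, Finset.card_range, nsmul_eq_mul] at h
  rw [norm_inv, Complex.norm_natCast]
  rcases Nat.eq_zero_or_pos N with rfl | hN
  · simp
  · have : (0 : ℝ) < N := by exact_mod_cast hN
    rw [inv_mul_le_iff₀ this]; exact h

lemma E_same (ω : Circle → O ≃⋆ₐ[ℂ] O) (k : ℤ) (N : ℕ) (hN : 0 < N) (b : O)
    (hb : ∀ t, ω t b = ((t : ℂ) ^ k) • b) : E ω k N b = b := by
  have : (N : ℂ) ≠ 0 := by exact_mod_cast hN.ne'
  simp only [E, hb, smul_smul]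
  have h2 : ∀ t : Circle, (t : ℂ) ^ (-k) * (t : ℂ) ^ k = 1 := fun t => by
    rw [← zpow_add₀ (Circle.coe_ne_zero t)]; simp
  simp only [h2, one_smul, Finset.sum_const, Finset.card_range]
  rw [← Nat.cast_smul_eq_nsmul ℂ, smul_smul, inv_mul_cancel₀ this, one_smul]

lemma E_diff (ω : Circle → O ≃⋆ₐ[ℂ] O) (k j : ℤ) (hj : j ≠ k) (N : ℕ) (hN : (j - k).natAbs < N)
    (b : O) (hb : ∀ t, ω t b = ((t : ℂ) ^ j) • b) : E ω k N b = 0 := by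
  simp only [E, hb, smul_smul]
  rw [← Finset.sum_smul]
  set ζ : Circle := Circle.exp (2 * Real.pi / N) with hζ
  have hN0 : N ≠ 0 := by omega
  have hp : IsPrimitiveRoot (ζ : ℂ) N := by
    have := Complex.isPrimitiveRoot_exp N hN0
    rw [hζ, Circle.coe_exp]
    convert this using 2
    push_cast; ring
  have h1 : ∀ l : ℕ, ((ζ ^ l : Circle) : ℂ) ^ (-k) * ((ζ ^ l : Circle) : ℂ) ^ j
      = ((ζ : ℂ) ^ (j - k)) ^ l := fun l => by
    rw [← zpow_add₀ (Circle.coe_ne_zero _), Circle.coe_pow, ← zpow_natCast, ← zpow_natCast,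
      ← zpow_mul, ← zpow_mul]
    congr 1; ring
  simp only [h1]
  have hw : (ζ : ℂ) ^ (j - k) ≠ 1 := by
    rw [Ne, hp.zpow_eq_one_iff_dvd]
    intro hd
    have := Int.natAbs_dvd_natAbs.2 hd
    have := Nat.le_of_dvd (by omega) this
    simp at this
    omega
  have hwN : ((ζ : ℂ) ^ (j - k)) ^ N = 1 := by
    rw [← zpow_natCast, ← zpow_mul, mul_comm, zpow_mul, zpow_natCast, hp.pow_eq_one, one_zpow]
  rw [geom_sum_eq hw, hwN]; simp

lemma approx (hiso : ∀ i j : Fin n, star (s i) * s j = if i = j then (1 : O) else 0)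
    (hsum : ∑ i : Fin n, s i * star (s i) = (1 : O))
    (hgen : (StarAlgebra.adjoin ℂ (Set.range s)).topologicalClosure = ⊤)
    (ω : Circle → O ≃⋆ₐ[ℂ] O)
    (hgauge : ∀ (t : Circle) (i : Fin n), ω t (s i) = (t : ℂ) • s i)
    (k : ℤ) (x : O) (hx : ∀ t : Circle, ω t x = ((t : ℂ) ^ k) • x) (ε : ℝ) (hε : 0 < ε) :
    ∃ y, A s k y ∧ ‖x - y‖ < ε := by
  have hxc : x ∈ closure (StarAlgebra.adjoin ℂ (Set.range s) : Set O) := by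
    rw [← StarSubalgebra.topologicalClosure_coe, hgen]; trivial
  obtain ⟨b, hb, hd⟩ := Metric.mem_closure_iff.1 hxc ε hε
  have key : ∃ y, A s k y ∧ ∃ N0, ∀ N, N0 < N → E ω k N b = y := by
    have := adjoin_span hiso hsum hb
    clear hd hb
    have z0 : A s k (0 : O) :=
      ⟨k.toNat, (-k).toNat, by omega, fun μ ν => ⟨0, by simp⟩⟩
    induction this using AddSubmonoid.closure_induction with
    | mem z hz =>
      obtain ⟨j, hz⟩ := hz
      have hg : ∀ t, ω t z = ((t : ℂ) ^ j) • z := by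
        obtain ⟨p, q, rfl, hV⟩ := hz
        exact fun t => V_omega hsum ω hgauge t hV
      by_cases hj : j = k
      · subst hj
        exact ⟨z, hz, 0, fun N hN => E_same ω j N hN z hg⟩
      · exact ⟨0, z0, _, fun N hN => E_diff ω k j hj N hN z hg⟩
    | zero => exact ⟨0, z0, 0, fun N hN => by simp [E]⟩
    | add a b _ _ h1 h2 =>
      obtain ⟨y1, a1, N1, h1⟩ := h1
      obtain ⟨y2, a2, N2, h2⟩ := h2
      exact ⟨y1 + y2, a1.add hiso a2, max N1 N2, fun N hN => by
        rw [E_add, h1 N (by omega), h2 N (by omega)]⟩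
  obtain ⟨y, hy, N0, hN⟩ := key
  refine ⟨y, hy, ?_⟩
  rw [← hN (N0 + 1) (by omega), ← E_same ω k (N0 + 1) (by omega) x hx, ← E_sub]
  rw [dist_eq_norm] at hd
  exact (E_norm ω k _ _).trans_lt hd


lemma T_succ (p : ℕ) (b : O) : T s (p + 1) b = ∑ i, star (s i) * T s p b * s i := by
  simp only [T_apply, wd, star_mul]
  rw [sum_succ p (fun μ i => star (s i) * star (wd s p μ) * b * (wd s p μ * s i))]
  refine Finset.sum_congr rfl fun i _ => ?_
  simp only [Finset.mul_sum, Finset.sum_mul, mul_assoc]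

lemma V_T {r : ℕ} {g : O} (h : V s r r g) : ∃ c : ℂ, T s r g = algebraMap ℂ O c := by
  choose c hc using h
  exact ⟨∑ μ, c μ μ, by rw [map_sum, T_apply]; simp only [hc]⟩

lemma tr_succ (hiso : ∀ i j : Fin n, star (s i) * s j = if i = j then (1 : O) else 0)
    (hn : n ≠ 0) {r : ℕ} {g : O} (h : V s r r g) : tr s (r + 1) g = tr s r g := by
  obtain ⟨c, hc⟩ := V_T h
  have hn' : (n : ℂ) ≠ 0 := by exact_mod_cast hn
  have : T s (r + 1) g = (n : ℂ) • T s r g := by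
    rw [T_succ, hc]
    have : ∀ i, star (s i) * algebraMap ℂ O c * s i = algebraMap ℂ O c := fun i => by
      rw [← Algebra.commutes, mul_assoc, hiso]; simp
    simp only [this, Finset.sum_const, Finset.card_univ, Fintype.card_fin]
    rw [Nat.cast_smul_eq_nsmul]
  rw [tr_apply, tr_apply, this, smul_smul]
  congr 1
  rw [pow_succ]
  field_simp

lemma tr_add (hiso : ∀ i j : Fin n, star (s i) * s j = if i = j then (1 : O) else 0)
    (hn : n ≠ 0) {r : ℕ} {g : O} (h : V s r r g) (m : ℕ) : tr s (r + m) g = tr s r g := by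
  induction m with
  | zero => rfl
  | succ m ih => rw [← ih, ← add_assoc, tr_succ hiso hn (V_add hiso h m)]

lemma tr_ge (hiso : ∀ i j : Fin n, star (s i) * s j = if i = j then (1 : O) else 0)
    (hn : n ≠ 0) {r : ℕ} {g : O} (h : V s r r g) {M : ℕ} (hM : r ≤ M) : tr s M g = tr s r g := by
  obtain ⟨m, rfl⟩ := Nat.exists_eq_add_of_le hM
  exact tr_add hiso hn h m

lemma T_scale (hsum : ∑ i : Fin n, s i * star (s i) = (1 : O)) {p q : ℕ} {z : O}
    (h : V s p q z) : T s p (z * star z) = T s q (star z * z) := by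
  have e1 : T s p (z * star z) = ∑ μ : Fin p → Fin n, ∑ ν : Fin q → Fin n,
      (star (wd s p μ) * z * wd s q ν) * star (star (wd s p μ) * z * wd s q ν) := by
    rw [T_apply]
    refine Finset.sum_congr rfl fun μ _ => ?_
    rw [← mul_one z, mul_assoc z 1, mul_one z, ← wd_sum hsum q]
    simp only [Finset.mul_sum, Finset.sum_mul, mul_assoc, star_mul, star_star]
  have e2 : T s q (star z * z) = ∑ ν : Fin q → Fin n, ∑ μ : Fin p → Fin n,
      star (star (wd s p μ) * z * wd s q ν) * (star (wd s p μ) * z * wd s q ν) := by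
    rw [T_apply]
    refine Finset.sum_congr rfl fun μ _ => ?_
    rw [← mul_one (star z), mul_assoc (star z) 1, ← wd_sum hsum p]
    simp only [Finset.mul_sum, Finset.sum_mul, mul_assoc, star_mul, star_star]
  rw [e1, e2, Finset.sum_comm]
  choose c hc using h
  simp only [hc]
  refine Finset.sum_congr rfl fun μ _ => Finset.sum_congr rfl fun ν _ => ?_
  exact Algebra.commutes _ _

lemma tr_scale (hiso : ∀ i j : Fin n, star (s i) * s j = if i = j then (1 : O) else 0)
    (hsum : ∑ i : Fin n, s i * star (s i) = (1 : O)) (hn : n ≠ 0) {r k : ℕ} {z : O}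
    (h : V s (r + k) r z) {M : ℕ} (hM : r + k ≤ M) :
    tr s M (star z * z) = ((n : ℂ) ^ k) • tr s M (z * star z) := by
  have hn' : (n : ℂ) ≠ 0 := by exact_mod_cast hn
  rw [tr_ge hiso hn (h.adj.mul hsum h) (by omega), tr_ge hiso hn (h.mul hsum h.adj) hM,
    tr_apply, tr_apply, T_scale hsum h, smul_smul]
  congr 1
  rw [pow_add]; field_simp

lemma norm_T_le (hiso : ∀ i j : Fin n, star (s i) * s j = if i = j then (1 : O) else 0)
    (p : ℕ) (b : O) : ‖T s p b‖ ≤ (n : ℝ) ^ p * ‖b‖ := by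
  rw [T_apply]
  have : ‖∑ μ : Fin p → Fin n, star (wd s p μ) * b * wd s p μ‖ ≤
      ∑ μ : Fin p → Fin n, ‖b‖ := by
    refine norm_sum_le_of_le _ fun μ _ => ?_
    have h1 := norm_wd_le hiso p μ
    calc _ ≤ ‖star (wd s p μ)‖ * ‖b‖ * ‖wd s p μ‖ := norm_mul₃_le
      _ ≤ 1 * ‖b‖ * 1 := by rw [norm_star]; gcongr
      _ = _ := by ring
  simpa using this

lemma norm_tr (p : ℕ) (b : O) : ‖tr s p b‖ = ((n : ℝ) ^ p)⁻¹ * ‖T s p b‖ := by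
  rw [tr_apply, norm_smul]; simp

lemma norm_tr_le (hiso : ∀ i j : Fin n, star (s i) * s j = if i = j then (1 : O) else 0)
    (hn : n ≠ 0) (p : ℕ) (b : O) : ‖tr s p b‖ ≤ ‖b‖ := by
  have : 0 < (n : ℝ) ^ p := by positivity
  rw [norm_tr, inv_mul_le_iff₀ this]
  exact norm_T_le hiso p b

section order
set_option linter.unusedSectionVars false
variable [PartialOrder O] [StarOrderedRing O]

lemma T_nonneg (p : ℕ) {b : O} (hb : 0 ≤ b) : 0 ≤ T s p b := by
  rw [T_apply]
  exact Finset.sum_nonneg fun μ _ => star_left_conjugate_nonneg hb _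

lemma norm_T_mono (p : ℕ) {a b : O} (ha : 0 ≤ a) (hab : a ≤ b) : ‖T s p a‖ ≤ ‖T s p b‖ := by
  refine CStarAlgebra.norm_le_norm_of_nonneg_of_le (T_nonneg p ha) ?_
  rw [← sub_nonneg, ← map_sub]
  exact T_nonneg p (sub_nonneg.2 hab)

lemma norm_tr_mono (p : ℕ) {a b : O} (ha : 0 ≤ a) (hab : a ≤ b) : ‖tr s p a‖ ≤ ‖tr s p b‖ := by
  rw [norm_tr, norm_tr]
  gcongr
  exact norm_T_mono p ha hab

lemma norm_tr_real_smul (p : ℕ) (c : ℝ) (hc : 0 ≤ c) (a : O) :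
    ‖tr s p (c • a)‖ = c * ‖tr s p a‖ := by
  rw [← Complex.coe_smul, map_smul, norm_smul]; simp [abs_of_nonneg hc]

lemma norm_le_T (hiso : ∀ i j : Fin n, star (s i) * s j = if i = j then (1 : O) else 0)
    (hsum : ∑ i : Fin n, s i * star (s i) = (1 : O)) (r : ℕ) (g : O) :
    ‖g‖ ≤ (n : ℝ) ^ r * √‖T s r (star g * g)‖ := by
  have e : g = ∑ ν : Fin r → Fin n, g * wd s r ν * star (wd s r ν) := by
    conv_lhs => rw [← mul_one g, ← wd_sum hsum r]
    simp only [Finset.mul_sum, mul_assoc]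
  have : ‖g‖ ≤ ∑ ν : Fin r → Fin n, √‖T s r (star g * g)‖ := by
    conv_lhs => rw [e]
    refine norm_sum_le_of_le _ fun ν _ => ?_
    have h1 := norm_wd_le hiso r ν
    have h2 : ‖g * wd s r ν‖ ≤ √‖T s r (star g * g)‖ := by
      apply Real.le_sqrt_of_sq_le
      rw [sq, ← CStarRing.norm_star_mul_self]
      refine CStarAlgebra.norm_le_norm_of_nonneg_of_le (star_mul_self_nonneg _) ?_
      rw [T_apply]
      have := Finset.single_le_sum (f := fun μ => star (wd s r μ) * (star g * g) * wd s r μ)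
        (fun μ _ => star_left_conjugate_nonneg (star_mul_self_nonneg g) _) (Finset.mem_univ ν)
      simpa only [star_mul, mul_assoc] using this
    calc _ ≤ ‖g * wd s r ν‖ * ‖star (wd s r ν)‖ := norm_mul_le _ _
      _ ≤ ‖g * wd s r ν‖ * 1 := by rw [norm_star]; gcongr
      _ ≤ _ := by rw [mul_one]; exact h2
  simpa using this

/-- `‖τ((u+v)*(u+v))‖ ≤ 2 (‖τ(u*u)‖ + ‖τ(v*v)‖)` -/
lemma tr_parallel (p : ℕ) (u v : O) : ‖tr s p (star (u + v) * (u + v))‖ ≤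
    2 * ‖tr s p (star u * u)‖ + 2 * ‖tr s p (star v * v)‖ := by
  have h : star (u + v) * (u + v) ≤ (2 : ℝ) • (star u * u) + (2 : ℝ) • (star v * v) := by
    rw [← sub_nonneg]
    have : (2 : ℝ) • (star u * u) + (2 : ℝ) • (star v * v) - star (u + v) * (u + v)
        = star (u - v) * (u - v) := by
      simp only [star_add, star_sub, two_smul]; noncomm_ring
    rw [this]; exact star_mul_self_nonneg _
  refine (norm_tr_mono p (star_mul_self_nonneg _) h).trans ?_
  rw [map_add]
  refine (norm_add_le _ _).trans ?_
  rw [norm_tr_real_smul p 2 (by norm_num), norm_tr_real_smul p 2 (by norm_num)]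

/-- `‖τ(b* a* a b)‖ ≤ ‖a‖² ‖τ(b*b)‖` -/
lemma tr_mul_le (p : ℕ) (a b : O) : ‖tr s p (star (a * b) * (a * b))‖ ≤
    ‖a‖ ^ 2 * ‖tr s p (star b * b)‖ := by
  have h : star (a * b) * (a * b) ≤ (‖a‖ ^ 2) • (star b * b) := by
    have := CStarAlgebra.star_left_conjugate_le_norm_smul (a := b) (b := star a * a)
      (.star_mul_self a)
    rw [CStarRing.norm_star_mul_self, ← sq] at this
    simpa only [star_mul, mul_assoc] using this
  refine (norm_tr_mono p (star_mul_self_nonneg _) h).trans ?_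
  rw [norm_tr_real_smul p _ (by positivity)]

/-- the scaling identity, in the limit -/
lemma scale_lim (hiso : ∀ i j : Fin n, star (s i) * s j = if i = j then (1 : O) else 0)
    (hsum : ∑ i : Fin n, s i * star (s i) = (1 : O)) (hn : n ≠ 0) (k : ℕ) (x : O)
    (hx : ∀ ε : ℝ, 0 < ε → ∃ y, A s k y ∧ ‖x - y‖ < ε) :
    Tendsto (fun M => tr s M (star x * x) - ((n : ℂ) ^ k) • tr s M (x * star x)) atTop (𝓝 0) := by
  rw [Metric.tendsto_atTop]
  intro ε hε
  set C : ℝ := (1 + (n : ℝ) ^ k) * (2 * ‖x‖ + 1) with hC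
  have hC0 : 0 < C := by positivity
  obtain ⟨y, ⟨p, r, e, hy⟩, hd⟩ := hx (min 1 (ε / C)) (lt_min one_pos (div_pos hε hC0))
  obtain rfl : p = r + k := by omega
  refine ⟨r + k, fun M hM => ?_⟩
  have h0 := tr_scale hiso hsum hn hy hM
  have hd1 : ‖x - y‖ < 1 := hd.trans_le (min_le_left _ _)
  have hd2 : ‖x - y‖ < ε / C := hd.trans_le (min_le_right _ _)
  have hyn : ‖y‖ ≤ ‖x‖ + 1 := by
    have := norm_le_norm_add_norm_sub x y
    linarith
  have b1 : ‖star x * x - star y * y‖ ≤ ‖x - y‖ * (2 * ‖x‖ + 1) := by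
    have : star x * x - star y * y = star x * (x - y) + star (x - y) * y := by
      rw [star_sub]; noncomm_ring
    rw [this]
    refine (norm_add_le _ _).trans ?_
    have h1 := norm_mul_le (star x) (x - y)
    have h2 := norm_mul_le (star (x - y)) y
    rw [norm_star] at h1 h2
    nlinarith [norm_nonneg (x - y)]
  have b2 : ‖x * star x - y * star y‖ ≤ ‖x - y‖ * (2 * ‖x‖ + 1) := by
    have : x * star x - y * star y = x * star (x - y) + (x - y) * star y := by
      rw [star_sub]; noncomm_ring
    rw [this]
    refine (norm_add_le _ _).trans ?_
    have h1 := norm_mul_le x (star (x - y))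
    have h2 := norm_mul_le (x - y) (star y)
    rw [norm_star] at h1 h2
    nlinarith [norm_nonneg (x - y)]
  have e : tr s M (star x * x) - ((n : ℂ) ^ k) • tr s M (x * star x) =
      tr s M (star x * x - star y * y) - ((n : ℂ) ^ k) • tr s M (x * star x - y * star y) := by
    rw [map_sub, map_sub, smul_sub, h0]; abel
  rw [dist_zero_right, e]
  refine (norm_sub_le _ _).trans_lt ?_
  rw [norm_smul, norm_pow, Complex.norm_natCast]
  have c1 := (norm_tr_le hiso hn M (star x * x - star y * y)).trans b1
  have c2 := (norm_tr_le hiso hn M (x * star x - y * star y)).trans b2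
  calc _ ≤ ‖x - y‖ * (2 * ‖x‖ + 1) + (n : ℝ) ^ k * (‖x - y‖ * (2 * ‖x‖ + 1)) := by gcongr
    _ = ‖x - y‖ * C := by rw [hC]; ring
    _ < ε := by rwa [lt_div_iff₀ hC0] at hd2

lemma normal_lim (hiso : ∀ i j : Fin n, star (s i) * s j = if i = j then (1 : O) else 0)
    (hsum : ∑ i : Fin n, s i * star (s i) = (1 : O)) (hn : 2 ≤ n) (k : ℕ) (hk : k ≠ 0) (x : O)
    (hx : ∀ ε : ℝ, 0 < ε → ∃ y, A s k y ∧ ‖x - y‖ < ε) (hnormal : x * star x = star x * x) :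
    Tendsto (fun M => tr s M (x * star x)) atTop (𝓝 0) := by
  have h := scale_lim hiso hsum (by omega) k x hx
  rw [← hnormal] at h
  have hne : (1 : ℂ) - (n : ℂ) ^ k ≠ 0 := by
    rw [sub_ne_zero]
    have : 1 < n ^ k := Nat.one_lt_pow hk (by omega)
    exact_mod_cast this.ne
  have h2 := h.const_smul ((1 - (n : ℂ) ^ k)⁻¹)
  rw [smul_zero] at h2
  refine h2.congr fun M => ?_
  rw [show tr s M (x * star x) - ((n : ℂ) ^ k) • tr s M (x * star x)
    = (1 - (n : ℂ) ^ k) • tr s M (x * star x) by rw [sub_smul, one_smul], smul_smul,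
    inv_mul_cancel₀ hne, one_smul]

lemma right_lim (hiso : ∀ i j : Fin n, star (s i) * s j = if i = j then (1 : O) else 0)
    (hsum : ∑ i : Fin n, s i * star (s i) = (1 : O)) (hn : 2 ≤ n) (k : ℕ) (hk : k ≠ 0) (x : O)
    (hx : ∀ ε : ℝ, 0 < ε → ∃ y, A s k y ∧ ‖x - y‖ < ε) (hnormal : x * star x = star x * x)
    (b : O) (hb : A s 0 b) :
    Tendsto (fun M => tr s M (star (x * b) * (x * b))) atTop (𝓝 0) := by
  have hxb : ∀ ε : ℝ, 0 < ε → ∃ y, A s k y ∧ ‖x * b - y‖ < ε := by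
    intro ε hε
    obtain ⟨y, hy, hd⟩ := hx (ε / (‖b‖ + 1)) (by positivity)
    refine ⟨y * b, by simpa using hy.mul hiso hsum hb, ?_⟩
    rw [← sub_mul]
    rw [lt_div_iff₀ (by positivity)] at hd
    refine (norm_mul_le _ _).trans_lt (lt_of_le_of_lt ?_ hd)
    gcongr; linarith
  have h1 := scale_lim hiso hsum (by omega) k (x * b) hxb
  have h2 : Tendsto (fun M => tr s M (x * b * star (x * b))) atTop (𝓝 0) := by
    have h3 := (normal_lim hiso hsum hn k hk x hx hnormal).norm.const_mul (‖star b‖ ^ 2)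
    rw [norm_zero, mul_zero] at h3
    refine squeeze_zero_norm (fun M => ?_) h3
    have := tr_mul_le (s := s) M (star b) (star x)
    simpa only [star_mul, star_star, mul_assoc] using this
  have h4 := h1.add (h2.const_smul ((n : ℂ) ^ k))
  simpa using h4

lemma final (hiso : ∀ i j : Fin n, star (s i) * s j = if i = j then (1 : O) else 0)
    (hsum : ∑ i : Fin n, s i * star (s i) = (1 : O)) (hn : 2 ≤ n) (k : ℕ) (hk : k ≠ 0) (x : O)
    (hx : ∀ ε : ℝ, 0 < ε → ∃ y, A s k y ∧ ‖x - y‖ < ε) (hnormal : x * star x = star x * x) :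
    x = 0 := by
  have hn0 : n ≠ 0 := by omega
  have main : ∀ ε : ℝ, 0 < ε → ‖x‖ ≤ 3 * ε := by
    intro ε hε
    obtain ⟨y, ⟨p, r, e, hy⟩, hd⟩ := hx ε hε
    obtain rfl : p = r + k := by omega
    set h := star y * y with hh
    have hV : V s r r h := hy.adj.mul hsum hy
    have hsa : IsSelfAdjoint h := .star_mul_self y
    -- one step
    have step : ∀ b, V s r r b → ‖tr s r (star (y * b) * (y * b))‖ ≤
        2 * ε ^ 2 * ‖tr s r (star b * b)‖ := by
      intro b hb
      have hyb : V s (r + k) r (y * b) := hy.mul hsum hb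
      have l := (right_lim hiso hsum hn k hk x hx hnormal b ⟨r, r, by simp, hb⟩).norm.const_mul 2
      have l2 := l.add_const (2 * (ε ^ 2 * ‖tr s r (star b * b)‖))
      rw [norm_zero, mul_zero, zero_add] at l2
      rw [mul_assoc]
      refine ge_of_tendsto l2 ?_
      filter_upwards [eventually_ge_atTop r] with M hM
      rw [← tr_ge hiso hn0 (hyb.adj.mul hsum hyb) hM, ← tr_ge hiso hn0 (hb.adj.mul hsum hb) hM]
      have p1 := tr_parallel (s := s) M (x * b) ((y - x) * b)
      rw [show x * b + (y - x) * b = y * b by noncomm_ring] at p1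
      refine p1.trans ?_
      have p2 := tr_mul_le (s := s) M (y - x) b
      have p3 : ‖y - x‖ ^ 2 ≤ ε ^ 2 := by
        rw [norm_sub_rev]; gcongr
      gcongr
      exact p2.trans (by gcongr)
    have iter : ∀ m : ℕ, ‖tr s r (star (h ^ m) * h ^ m)‖ ≤ (2 * ε ^ 2 * ‖y‖ ^ 2) ^ m := by
      intro m
      induction m with
      | zero =>
        nontriviality O
        simpa using norm_tr_le hiso hn0 r (1 : O)
      | succ m ih =>
        have e1 : h ^ (m + 1) = star y * (y * h ^ m) := by rw [pow_succ', hh, mul_assoc]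
        rw [e1]
        refine (tr_mul_le r _ _).trans ?_
        have := step _ (V_pow hiso hsum hV m)
        rw [norm_star, pow_succ (2 * ε ^ 2 * ‖y‖ ^ 2)]
        calc _ ≤ ‖y‖ ^ 2 * (2 * ε ^ 2 * ‖tr s r (star (h ^ m) * h ^ m)‖) := by gcongr
          _ ≤ ‖y‖ ^ 2 * (2 * ε ^ 2 * (2 * ε ^ 2 * ‖y‖ ^ 2) ^ m) := by gcongr
          _ = _ := by ring
    have npos : 0 < (n : ℝ) ^ r := by positivity
    have bound : ∀ j : ℕ, (‖y‖ ^ 4) ^ (2 ^ j) ≤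
        (n : ℝ) ^ r * (n : ℝ) ^ r * (n : ℝ) ^ r * (2 * ε ^ 2 * ‖y‖ ^ 2) ^ (2 ^ j) := by
      intro j
      have b1 := norm_le_T hiso hsum r (h ^ (2 ^ j))
      have b2 := iter (2 ^ j)
      rw [norm_tr, inv_mul_le_iff₀ npos] at b2
      rw [hsa.norm_pow_two_pow, hh, CStarRing.norm_star_mul_self, ← hh] at b1
      have b3 : ((‖y‖ * ‖y‖) ^ 2 ^ j) ^ 2 ≤
          ((n : ℝ) ^ r * √‖T s r (star (h ^ 2 ^ j) * h ^ 2 ^ j)‖) ^ 2 := by gcongr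
      rw [mul_pow _ (√_), Real.sq_sqrt (norm_nonneg _)] at b3
      calc (‖y‖ ^ 4) ^ (2 ^ j) = ((‖y‖ * ‖y‖) ^ 2 ^ j) ^ 2 := by ring
        _ ≤ _ := b3
        _ ≤ ((n : ℝ) ^ r) ^ 2 * ((n : ℝ) ^ r * (2 * ε ^ 2 * ‖y‖ ^ 2) ^ 2 ^ j) := by gcongr
        _ = _ := by ring
    have hy2 : ‖y‖ ≤ 2 * ε := by
      by_contra! hlt
      have hy0 : 0 < ‖y‖ := by linarith
      have hq : (2 * ε ^ 2 * ‖y‖ ^ 2) / ‖y‖ ^ 4 < 1 := by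
        rw [div_lt_one (by positivity)]
        have : 2 * ε ^ 2 < ‖y‖ ^ 2 := by nlinarith
        nlinarith [mul_lt_mul_of_pos_right this (pow_pos hy0 2)]
      have t1 := (tendsto_pow_atTop_nhds_zero_of_lt_one (by positivity) hq).comp
        (tendsto_pow_atTop_atTop_of_one_lt (one_lt_two (α := ℕ)))
      have t2 := t1.const_mul ((n : ℝ) ^ r * (n : ℝ) ^ r * (n : ℝ) ^ r)
      rw [mul_zero] at t2
      have : (1 : ℝ) ≤ 0 := by
        refine ge_of_tendsto' t2 fun j => ?_
        simp only [Function.comp]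
        rw [div_pow, ← mul_div_assoc, le_div_iff₀ (by positivity), one_mul]
        exact bound j
      linarith
    have := norm_le_norm_add_norm_sub' x y
    linarith
  rw [← norm_le_zero_iff]
  refine le_of_forall_pos_le_add fun ε hε => ?_
  have := main (ε / 3) (by positivity)
  linarith

end order
end
end CuntzAux

/-- In the Cuntz algebra `𝒪ₙ` (`n ≥ 2`), presented as a C*-algebra generated by
isometries `s i` with `sᵢ* sⱼ = δ_{ij}` and `Σ sᵢ sᵢ* = 1`, with gauge circle
action `ω_t(sᵢ) = t sᵢ`: any normal element `x` of nonzero grade `k`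
(i.e. `ω_t(x) = t^k x`, `k ≠ 0`) is zero. -/
theorem cuntz_normal_nonzero_grade_eq_zero
    {O : Type*} [CStarAlgebra O] (n : ℕ) (hn : 2 ≤ n) (s : Fin n → O)
    (hiso : ∀ i j : Fin n, star (s i) * s j = if i = j then (1 : O) else 0)
    (hsum : ∑ i : Fin n, s i * star (s i) = (1 : O))
    (hgen : (StarAlgebra.adjoin ℂ (Set.range s)).topologicalClosure = ⊤)
    (ω : Circle → O ≃⋆ₐ[ℂ] O)
    (hω : ∀ u t : Circle, ∀ b : O, ω (u * t) b = ω u (ω t b))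
    (hωcont : ∀ b : O, Continuous fun t : Circle => ω t b)
    (hgauge : ∀ (t : Circle) (i : Fin n), ω t (s i) = (t : ℂ) • s i)
    (k : ℤ) (hk : k ≠ 0) (x : O)
    (hx : ∀ t : Circle, ω t x = ((t : ℂ) ^ k) • x)
    (hnormal : x * star x = star x * x) :
    x = 0 := by
  obtain ⟨_, _⟩ : ∃ o : PartialOrder O, StarOrderedRing O :=
    ⟨CStarAlgebra.spectralOrder O, CStarAlgebra.spectralOrderedRing O⟩
  rcases lt_or_gt_of_ne hk with hneg | hpos
  · have hx' : ∀ t : Circle, ω t (star x) = ((t : ℂ) ^ (-k)) • star x := fun t => by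
      rw [map_star, hx, star_smul, CuntzAux.star_zpow_circle]
    obtain ⟨m, hm⟩ := Int.eq_ofNat_of_zero_le (show 0 ≤ -k by omega)
    have := CuntzAux.final hiso hsum hn m (by omega) (star x)
      (fun ε hε => CuntzAux.approx hiso hsum hgen ω hgauge m (star x) (hm ▸ hx') ε hε)
      (by rw [star_star, hnormal])
    exact star_eq_zero.1 this
  · obtain ⟨m, rfl⟩ := Int.eq_ofNat_of_zero_le hpos.le
    exact CuntzAux.final hiso hsum hn m (by omega) x
      (fun ε hε => CuntzAux.approx hiso hsum hgen ω hgauge m x hx ε hε) hnormal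
end

section
/- Let A be a subalgebra of the Cuntz algebra 𝒪ₙ that is maximal among abelian 𝕋-invariant *-subalgebras (with respect to the gauge action ω). Then A is contained in the fixed-point algebra 𝒪ₙ⁰ = {x : ω_t(x) = x for all t ∈ 𝕋}. -/
/-- Words of length `m` in `n` letters. -/
def CzIdx (n : ℕ) : ℕ → Type
  | 0 => Unit
  | m + 1 => CzIdx n m × Fin n

instance czFintype (n : ℕ) : (m : ℕ) → Fintype (CzIdx n m)
  | 0 => inferInstanceAs (Fintype Unit)
  | m + 1 =>
    letI := czFintype n m
    inferInstanceAs (Fintype (CzIdx n m × Fin n))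

instance czDecEq (n : ℕ) : (m : ℕ) → DecidableEq (CzIdx n m)
  | 0 => inferInstanceAs (DecidableEq Unit)
  | m + 1 =>
    letI := czDecEq n m
    inferInstanceAs (DecidableEq (CzIdx n m × Fin n))

noncomputable section

variable {O : Type*} [CStarAlgebra O] {n : ℕ} (s : Fin n → O)

/-- The isometry attached to a word. -/
def czS : (m : ℕ) → CzIdx n m → O
  | 0, _ => 1
  | m + 1, μ => czS m μ.1 * s μ.2

lemma czSum_succ {M : Type*} [AddCommMonoid M] (m : ℕ) (f : CzIdx n (m + 1) → M) :
    ∑ μ, f μ = ∑ μ : CzIdx n m, ∑ i : Fin n, f (μ, i) :=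
  Fintype.sum_prod_type (α₁ := CzIdx n m) (α₂ := Fin n) f

lemma czSum_zero {M : Type*} [AddCommMonoid M] (f : CzIdx n 0 → M) :
    ∑ μ, f μ = f () := Fintype.sum_unique (ι := Unit) f

variable (hiso : ∀ i j : Fin n, star (s i) * s j = if i = j then (1 : O) else 0)
  (hsum : ∑ i : Fin n, s i * star (s i) = (1 : O))

include hiso in
lemma czS_iso (m : ℕ) (μ ν : CzIdx n m) :
    star (czS s m μ) * czS s m ν = if μ = ν then (1 : O) else 0 := by
  induction m with
  | zero =>
    have : μ = ν := Subsingleton.elim (α := Unit) _ _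
    simp [czS, this]
  | succ m ih =>
    obtain ⟨μ, i⟩ := μ
    obtain ⟨ν, j⟩ := ν
    have h : star (czS s (m+1) (μ, i)) * czS s (m+1) (ν, j)
      = star (s i) * (star (czS s m μ) * czS s m ν) * s j := by
      simp [czS, mul_assoc]
    rw [h, ih]
    by_cases h1 : μ = ν
    · subst h1
      simp only [if_true, mul_one, hiso]
      by_cases h2 : i = j
      · subst h2; rw [if_pos rfl]; exact (if_pos rfl).symm
      · rw [if_neg h2]; exact (if_neg (fun h => h2 (Prod.mk.inj h).2)).symm
    · rw [if_neg h1, mul_zero, zero_mul]; exact (if_neg (fun h => h1 (Prod.mk.inj h).1)).symm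

include hsum in
lemma czS_sum (m : ℕ) : ∑ μ, czS s m μ * star (czS s m μ) = 1 := by
  induction m with
  | zero => rw [czSum_zero]; simp [czS]
  | succ m ih =>
    rw [czSum_succ, ← ih]
    refine Finset.sum_congr rfl fun μ _ => ?_
    calc ∑ i, czS s (m+1) (μ, i) * star (czS s (m+1) (μ, i))
        = czS s m μ * (∑ i, s i * star (s i)) * star (czS s m μ) := by
          simp [czS, Finset.mul_sum, Finset.sum_mul, mul_assoc]
      _ = _ := by rw [hsum, mul_one]

/-- Unnormalised compression map. -/
def czPhi (m : ℕ) (a : O) : O := ∑ μ, star (czS s m μ) * a * czS s m μ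

/-- One step of the compression map. -/
def czPsi (a : O) : O := ∑ i, star (s i) * a * s i

lemma czPhi_succ (m : ℕ) (a : O) : czPhi s (m + 1) a = czPsi s (czPhi s m a) := by
  unfold czPhi czPsi
  rw [czSum_succ, Finset.sum_comm]
  refine Finset.sum_congr rfl fun i _ => ?_
  simp [czS, Finset.mul_sum, Finset.sum_mul, mul_assoc]

include hiso in
lemma czPsi_one (c : ℂ) : czPsi s (c • (1 : O)) = ((n : ℂ) * c) • (1 : O) := by
  simp [czPsi, hiso, ← Nat.cast_smul_eq_nsmul ℂ, smul_smul]

include hiso in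
lemma czPhi_add (m j : ℕ) (a : O) (c : ℂ) (h : czPhi s m a = c • 1) :
    czPhi s (m + j) a = ((n : ℂ) ^ j * c) • 1 := by
  induction j with
  | zero => simpa using h
  | succ j ih => rw [← add_assoc, czPhi_succ, ih, czPsi_one s hiso]; congr 1; ring

include hiso in
lemma cz_norm_le (i : Fin n) : ‖s i‖ ≤ 1 := by
  have h : ‖s i‖ * ‖s i‖ = ‖(1 : O)‖ := by
    rw [← CStarRing.norm_star_mul_self, hiso, if_pos rfl]
  have h1 : ‖(1 : O)‖ ≤ 1 := by
    rcases subsingleton_or_nontrivial O with h0 | h0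
    · rw [Subsingleton.elim (1 : O) 0]; simp
    · simp
  nlinarith [norm_nonneg (s i)]

include hiso in
lemma czPsi_norm (a : O) : ‖czPsi s a‖ ≤ n * ‖a‖ := by
  unfold czPsi
  refine (norm_sum_le _ _).trans ?_
  have : ∀ i ∈ Finset.univ, ‖star (s i) * a * s i‖ ≤ ‖a‖ := by
    intro i _
    have h := cz_norm_le s hiso i
    calc ‖star (s i) * a * s i‖ ≤ ‖star (s i)‖ * ‖a‖ * ‖s i‖ :=
          (norm_mul_le _ _).trans (by gcongr; exact norm_mul_le _ _)
      _ ≤ 1 * ‖a‖ * 1 := by gcongr; rwa [norm_star]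
      _ = ‖a‖ := by ring
  refine (Finset.sum_le_sum this).trans ?_
  simp

include hiso in
lemma czPhi_norm_add (m j : ℕ) (a : O) : ‖czPhi s (m + j) a‖ ≤ n ^ j * ‖czPhi s m a‖ := by
  induction j with
  | zero => simp
  | succ j ih =>
    rw [← add_assoc, czPhi_succ]
    refine (czPsi_norm s hiso _).trans ?_
    calc (n : ℝ) * ‖czPhi s (m + j) a‖ ≤ n * (n ^ j * ‖czPhi s m a‖) := by gcongr
      _ = _ := by ring

include hiso in
lemma czPhi_norm (m : ℕ) (a : O) : ‖czPhi s m a‖ ≤ n ^ m * ‖a‖ := by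
  have := czPhi_norm_add s hiso 0 m a
  have h0 : czPhi s 0 a = a := by unfold czPhi; rw [czSum_zero]; simp [czS]
  rwa [h0, zero_add] at this

lemma czPhi_sub (m : ℕ) (a b : O) : czPhi s m (a - b) = czPhi s m a - czPhi s m b := by
  simp [czPhi, mul_sub, sub_mul]

/-- Linear combination of words. -/
def czLin (m : ℕ) (d : CzIdx n m → ℂ) : O := ∑ μ, d μ • czS s m μ

include hiso in
lemma czLin_inner (m : ℕ) (d : CzIdx n m → ℂ) :
    star (czLin s m d) * czLin s m d = ((∑ μ, ‖d μ‖ ^ 2 : ℝ) : ℂ) • (1 : O) := by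
  unfold czLin
  simp only [star_sum, Finset.sum_mul, Finset.mul_sum, star_smul, smul_mul_smul_comm,
    czS_iso s hiso]
  simp only [smul_ite, smul_zero, Finset.mem_univ, if_true,
    Finset.sum_ite_eq', Finset.sum_smul, Complex.ofReal_sum]
  refine Finset.sum_congr rfl fun μ _ => ?_
  congr 1
  simp [Complex.conj_mul']

/-- Matrix combination of words. -/
def czMat {p q : ℕ} (c : Matrix (CzIdx n p) (CzIdx n q) ℂ) : O :=
  ∑ μ, ∑ ν, c μ ν • (czS s p μ * star (czS s q ν))

open scoped Matrix in
lemma czMat_star {p q : ℕ} (c : Matrix (CzIdx n p) (CzIdx n q) ℂ) :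
    star (czMat s c) = czMat s cᴴ := by
  unfold czMat
  rw [Finset.sum_comm]
  simp [star_sum, Matrix.conjTranspose_apply]

include hiso in
lemma czMat_lin {p q : ℕ} (c : Matrix (CzIdx n p) (CzIdx n q) ℂ) (d : CzIdx n q → ℂ) :
    czMat s c * czLin s q d = czLin s p (c.mulVec d) := by
  unfold czMat czLin
  simp only [Finset.sum_mul, Finset.mul_sum, smul_mul_smul_comm, mul_assoc, czS_iso s hiso]
  simp only [Matrix.mulVec, dotProduct, Finset.sum_smul]
  rw [Finset.sum_comm' (s' := fun _ => Finset.univ) (t' := Finset.univ) (by simp)]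
  simp

include hiso in
lemma czMat_mul {p q r : ℕ} (c : Matrix (CzIdx n p) (CzIdx n q) ℂ)
    (d : Matrix (CzIdx n q) (CzIdx n r) ℂ) :
    czMat s c * czMat s d = czMat s (c * d) := by
  have h : czMat s d = ∑ ν, czLin s q (fun μ => d μ ν) * star (czS s r ν) := by
    unfold czMat czLin
    rw [Finset.sum_comm]
    simp [Finset.sum_mul]
  have h' : czMat s (c * d) = ∑ ν, czLin s p (fun μ => (c * d) μ ν) * star (czS s r ν) := by
    unfold czMat czLin
    rw [Finset.sum_comm]
    simp [Finset.sum_mul]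
  rw [h, h', Finset.mul_sum]
  refine Finset.sum_congr rfl fun ν _ => ?_
  rw [← mul_assoc, czMat_lin s hiso]
  rfl

lemma czLin_single {q : ℕ} (ρ : CzIdx n q) : czLin s q (Pi.single ρ 1) = czS s q ρ := by
  unfold czLin
  rw [Finset.sum_eq_single ρ]
  · simp
  · intro b _ hb; simp [hb]
  · simp

include hiso in
lemma czPhi_kms {p q : ℕ} (c : Matrix (CzIdx n p) (CzIdx n q) ℂ) :
    czPhi s q (star (czMat s c) * czMat s c) = ((∑ ν, ∑ μ, ‖c μ ν‖ ^ 2 : ℝ) : ℂ) • (1 : O) := by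
  unfold czPhi
  rw [Complex.ofReal_sum, Finset.sum_smul]
  refine Finset.sum_congr rfl fun ν _ => ?_
  have h : star (czS s q ν) * (star (czMat s c) * czMat s c) * czS s q ν
    = star (czMat s c * czS s q ν) * (czMat s c * czS s q ν) := by simp [mul_assoc]
  rw [h, ← czLin_single, czMat_lin s hiso, czLin_inner s hiso]
  simp

open scoped Matrix in
include hiso in
lemma czPhi_kms' {p q : ℕ} (c : Matrix (CzIdx n p) (CzIdx n q) ℂ) :
    czPhi s p (czMat s c * star (czMat s c)) = ((∑ ν, ∑ μ, ‖c μ ν‖ ^ 2 : ℝ) : ℂ) • (1 : O) := by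
  have := czPhi_kms s hiso cᴴ
  rw [← czMat_star, star_star] at this
  rw [this, Finset.sum_comm]
  simp

open scoped Matrix.Norms.L2Operator in
include hiso hsum in
lemma czMat_norm_sq {p q : ℕ} (c : Matrix (CzIdx n p) (CzIdx n q) ℂ) :
    ‖czMat s c‖ ≤ ‖c‖ := by
  classical
  let φ : Matrix (CzIdx n q) (CzIdx n q) ℂ →⋆ₐ[ℂ] O :=
    { toFun := fun M => czMat s M
      map_one' := by
        rw [← czS_sum s hsum q]
        unfold czMat
        simp [Matrix.one_apply]
      map_mul' := fun A B => (czMat_mul s hiso A B).symm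
      map_zero' := by simp [czMat]
      map_add' := fun A B => by simp [czMat, add_smul, Finset.sum_add_distrib]
      commutes' := fun r => by
        rw [Algebra.algebraMap_eq_smul_one, Algebra.algebraMap_eq_smul_one,
          ← czS_sum s hsum q]
        unfold czMat
        simp [Matrix.one_apply, Finset.smul_sum]
      map_star' := fun A => (czMat_star s A).symm }
  have h1 : ‖φ (c.conjTranspose * c)‖ ≤ ‖c.conjTranspose * c‖ :=
    NonUnitalStarAlgHom.norm_apply_le φ _
  have h2 : φ (c.conjTranspose * c) = star (czMat s c) * czMat s c := by
    rw [czMat_star, czMat_mul s hiso]; rfl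
  rw [h2, CStarRing.norm_star_mul_self, Matrix.l2_opNorm_conjTranspose_mul_self] at h1
  nlinarith [norm_nonneg (czMat s c), norm_nonneg c]

open scoped Matrix.Norms.L2Operator in
include hiso hsum in
lemma czMat_vec {p q : ℕ} (c : Matrix (CzIdx n p) (CzIdx n q) ℂ) (r : ℝ) (hr0 : 0 ≤ r)
    (hr : r < ‖czMat s c‖) :
    ∃ v : CzIdx n q → ℂ, ∑ ν, ‖v ν‖ ^ 2 ≤ 1 ∧ r ^ 2 < ∑ μ, ‖c.mulVec v μ‖ ^ 2 := by
  classical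
  have h := hr.trans_le (czMat_norm_sq s hiso hsum c)
  rw [Matrix.l2_opNorm_def] at h
  obtain ⟨v, hv, hv'⟩ := ContinuousLinearMap.exists_lt_apply_of_lt_opNorm _ h
  refine ⟨v.ofLp, ?_, ?_⟩
  · rw [← EuclideanSpace.norm_sq_eq]
    nlinarith [norm_nonneg v]
  · have h2 := EuclideanSpace.norm_sq_eq (WithLp.toLp 2 (c.mulVec v.ofLp))
    simp only at h2
    rw [← h2]
    have h3 : r < ‖WithLp.toLp 2 (c.mulVec v.ofLp)‖ := hv'
    gcongr

section order

variable [PartialOrder O] [StarOrderedRing O]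

lemma cz_cauchy {ι : Type*} [Fintype ι] (v : ι → ℂ) (z : ι → O) (hv : ∑ i, ‖v i‖ ^ 2 ≤ 1) :
    star (∑ i, v i • z i) * (∑ i, v i • z i) ≤ ∑ i, star (z i) * z i := by
  set w := ∑ i, v i • z i with hw
  have h0 : 0 ≤ ∑ i, star (z i - star (v i) • w) * (z i - star (v i) • w) :=
    Finset.sum_nonneg fun i _ => star_mul_self_nonneg _
  have h1 : ∑ i, star (z i - star (v i) • w) * (z i - star (v i) • w)
      = ∑ i, star (z i) * z i - star w * w
        - ((1 - ∑ i, ‖v i‖ ^ 2 : ℝ)) • (star w * w) := by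
    have e1 : ∀ i, star (z i - star (v i) • w) * (z i - star (v i) • w)
      = star (z i) * z i - star (v i • z i) * w - star w * (v i • z i)
        + (‖v i‖ ^ 2) • (star w * w) := by
      intro i
      have : (‖v i‖ ^ 2) • (star w * w) = (v i * star (v i)) • (star w * w) := by
        rw [← Complex.coe_smul]
        congr 1
        simp [Complex.mul_conj']
      rw [this]
      simp only [star_sub, star_smul, star_star, sub_mul, mul_sub,
        smul_mul_assoc, mul_smul_comm, smul_sub]
      rw [smul_smul, mul_comm (star (v i))]
      abel
    simp only [e1, Finset.sum_add_distrib, Finset.sum_sub_distrib, ← Finset.sum_mul,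
      ← Finset.mul_sum, ← star_sum, ← hw, ← Finset.sum_smul]
    rw [sub_smul, one_smul]
    abel
  have h2 : 0 ≤ ((1 - ∑ i, ‖v i‖ ^ 2 : ℝ)) • (star w * w) :=
    smul_nonneg (by linarith) (star_mul_self_nonneg _)
  rw [h1] at h0
  have h3 := add_nonneg h0 h2
  rw [sub_add_cancel] at h3
  exact sub_nonneg.mp h3

include hiso in
lemma czPsi_lower (c : ℝ) (a : O) (h : c • (1 : O) ≤ a) :
    ((n : ℝ) * c) • (1 : O) ≤ czPsi s a := by
  have : ((n : ℝ) * c) • (1 : O) = ∑ i, star (s i) * (c • (1 : O)) * s i := by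
    simp [hiso, ← Nat.cast_smul_eq_nsmul ℝ, smul_smul]
  rw [this]
  exact Finset.sum_le_sum fun i _ => star_left_conjugate_le_conjugate h _

include hiso in
lemma czPhi_lower (m j : ℕ) (c : ℝ) (a : O) (h : c • (1 : O) ≤ czPhi s m a) :
    ((n : ℝ) ^ j * c) • (1 : O) ≤ czPhi s (m + j) a := by
  induction j with
  | zero => simpa using h
  | succ j ih =>
    rw [← add_assoc, czPhi_succ]
    have := czPsi_lower s hiso _ _ ih
    rwa [← mul_assoc, ← pow_succ'] at this

include hiso hsum in
lemma czPhi_lower_exists {p q : ℕ} (c : Matrix (CzIdx n p) (CzIdx n q) ℂ) (x : O) (ε : ℝ)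
    (hε : 0 < ε) (hx : 4 * ε < ‖x‖) (hc : ‖x - czMat s c‖ ≤ ε) :
    (2 * ε ^ 2) • (1 : O) ≤ czPhi s q (star x * x) := by
  have h0 : 3 * ε < ‖czMat s c‖ := by
    have := norm_sub_norm_le x (czMat s c)
    linarith
  obtain ⟨v, hv, hv'⟩ := czMat_vec s hiso hsum c _ (by positivity) h0
  set V := czLin s q v with hV
  set R := ∑ μ, ‖c.mulVec v μ‖ ^ 2 with hR
  have hnt : Nontrivial O := ⟨x, 0, fun h => by simp [h] at hx; linarith⟩
  have hVV : star V * V = ((∑ ν, ‖v ν‖ ^ 2 : ℝ) : ℂ) • (1 : O) := czLin_inner s hiso q v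
  have hVn : ‖V‖ ≤ 1 := by
    have h1 : ‖V‖ * ‖V‖ = ∑ ν, ‖v ν‖ ^ 2 := by
      rw [← CStarRing.norm_star_mul_self, hVV, norm_smul, norm_one, mul_one, Complex.norm_real,
        Real.norm_of_nonneg (by positivity)]
    nlinarith [norm_nonneg V]
  set w := x * V with hw
  set w0 := czMat s c * V with hw0
  have hw0w0 : star w0 * w0 = (R : ℂ) • (1 : O) := by
    rw [hw0, hV, czMat_lin s hiso, czLin_inner s hiso]
  have hw0n : ‖w0‖ ^ 2 = R := by
    rw [pow_two, ← CStarRing.norm_star_mul_self, hw0w0, norm_smul, norm_one, mul_one,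
      Complex.norm_real, Real.norm_of_nonneg (by positivity)]
  have hdiff : ‖w - w0‖ ≤ ε := by
    rw [hw, hw0, ← sub_mul]
    calc _ ≤ ‖x - czMat s c‖ * ‖V‖ := norm_mul_le _ _
      _ ≤ ε * 1 := by gcongr
      _ = ε := mul_one _
  have hwn : ‖w‖ ≤ ‖w0‖ + ε := by
    have := norm_sub_norm_le w w0
    linarith
  have hdd : ‖star w0 * w0 - star w * w‖ ≤ ε * (2 * ‖w0‖ + ε) := by
    have e : star w0 * w0 - star w * w = -(star (w - w0) * w) - star w0 * (w - w0) := by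
      simp only [star_sub]; noncomm_ring
    rw [e]
    calc _ ≤ ‖-(star (w - w0) * w)‖ + ‖star w0 * (w - w0)‖ := norm_sub_le _ _
      _ ≤ ‖w - w0‖ * ‖w‖ + ‖w0‖ * ‖w - w0‖ := by
        rw [norm_neg]
        gcongr
        · exact (norm_mul_le _ _).trans (by rw [norm_star])
        · exact (norm_mul_le _ _).trans (by rw [norm_star])
      _ ≤ ε * (‖w0‖ + ε) + ‖w0‖ * ε := by gcongr
      _ = _ := by ring
  have hsa : IsSelfAdjoint (star w0 * w0 - star w * w) :=
    (IsSelfAdjoint.star_mul_self _).sub (IsSelfAdjoint.star_mul_self _)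
  have h3 := hsa.le_algebraMap_norm_self
  rw [Algebra.algebraMap_eq_smul_one] at h3
  have hmono : ∀ a b : ℝ, a ≤ b → a • (1 : O) ≤ b • (1 : O) := fun a b hab =>
    smul_le_smul_of_nonneg_right hab zero_le_one
  have h4 : star w0 * w0 - star w * w ≤ (R - 2 * ε ^ 2) • (1 : O) := by
    refine h3.trans (hmono _ _ (hdd.trans ?_))
    rw [← hw0n] at hv' ⊢
    have : 3 * ε < ‖w0‖ := lt_of_pow_lt_pow_left₀ 2 (norm_nonneg _) hv'
    nlinarith
  rw [hw0w0, Complex.coe_smul, sub_smul, sub_le_sub_iff_left] at h4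
  refine h4.trans ?_
  have h5 := cz_cauchy v (fun ν => x * czS s q ν) hv
  have h6 : ∑ ν, v ν • (x * czS s q ν) = w := by
    rw [hw, hV, czLin, Finset.mul_sum]
    simp
  rw [h6] at h5
  refine h5.trans (le_of_eq ?_)
  unfold czPhi
  simp [mul_assoc]

end order

/-- The span of the words of bidegree `(p, q)`. -/
def czW (p q : ℕ) : Submodule ℂ O :=
  Submodule.span ℂ (Set.range fun μν : CzIdx n p × CzIdx n q =>
    czS s p μν.1 * star (czS s q μν.2))

/-- Key lemma: a normal element approximable by elements of bidegree `(q + k, q)` is zero. -/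
lemma cz_normal_zero (hn : 2 ≤ n) (hiso : ∀ i j : Fin n, star (s i) * s j = if i = j then (1 : O) else 0)
    (hsum : ∑ i : Fin n, s i * star (s i) = (1 : O)) (k : ℕ) (hk : 1 ≤ k) (x : O)
    (hx : star x * x = x * star x)
    (happ : ∀ ε : ℝ, 0 < ε → ∃ q, ∃ c : Matrix (CzIdx n (q + k)) (CzIdx n q) ℂ,
      ‖x - czMat s c‖ ≤ ε) : x = 0 := by
  by_contra hx0
  let _ := CStarAlgebra.spectralOrder O
  have _ := CStarAlgebra.spectralOrderedRing O
  have hnt : Nontrivial O := ⟨x, 0, hx0⟩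
  have hpos : 0 < ‖x‖ := norm_pos_iff.mpr hx0
  have hn0 : (0 : ℝ) < n := by exact_mod_cast (by omega : 0 < n)
  obtain ⟨q, c, hc⟩ := happ (‖x‖ / 5) (by positivity)
  have hlow := czPhi_lower_exists s hiso hsum c x (‖x‖ / 5) (by positivity) (by linarith) hc
  set κ := 2 * (‖x‖ / 5) ^ 2 with hκ
  have hκ0 : 0 < κ := by positivity
  -- upper bound
  set M := ‖x‖ with hM
  set δ : ℝ := min M (κ / (n : ℝ) ^ q / (12 * M)) with hδ
  have hδ0 : 0 < δ := by positivity
  obtain ⟨q2, d, hd⟩ := happ δ hδ0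
  set x0 := czMat s d with hx0'
  set σ : ℝ := ∑ ν, ∑ μ, ‖d μ ν‖ ^ 2 with hσ
  have hσ0 : 0 ≤ σ := by positivity
  obtain ⟨p, hp⟩ : ∃ p, p = q2 + k := ⟨_, rfl⟩
  have k1 : czPhi s p (x0 * star x0) = (σ : ℂ) • (1 : O) := by
    rw [hp]
    exact czPhi_kms' s hiso d
  have k2 : czPhi s p (star x0 * x0) = ((n : ℂ) ^ k * σ) • (1 : O) := by
    rw [hp]
    exact czPhi_add s hiso q2 k _ _ (czPhi_kms s hiso d)
  have hx0n : ‖x0‖ ≤ M + δ := by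
    have := norm_sub_norm_le x0 x
    rw [norm_sub_rev] at this
    linarith
  have hδM : δ ≤ M := min_le_left _ _
  have e1 : ‖star x * x - star x0 * x0‖ ≤ 3 * M * δ := by
    have e : star x * x - star x0 * x0 = star (x - x0) * x + star x0 * (x - x0) := by
      simp only [star_sub]; noncomm_ring
    rw [e]
    calc _ ≤ ‖x - x0‖ * ‖x‖ + ‖x0‖ * ‖x - x0‖ := by
          refine (norm_add_le _ _).trans ?_
          gcongr
          · exact (norm_mul_le _ _).trans (by rw [norm_star])
          · exact (norm_mul_le _ _).trans (by rw [norm_star])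
      _ ≤ δ * M + (M + δ) * δ := by gcongr
      _ ≤ 3 * M * δ := by nlinarith
  have e2 : ‖x * star x - x0 * star x0‖ ≤ 3 * M * δ := by
    have e : x * star x - x0 * star x0 = (x - x0) * star x + x0 * star (x - x0) := by
      simp only [star_sub]; noncomm_ring
    rw [e]
    calc _ ≤ ‖x - x0‖ * ‖x‖ + ‖x0‖ * ‖x - x0‖ := by
          refine (norm_add_le _ _).trans ?_
          gcongr
          · exact (norm_mul_le _ _).trans (by rw [norm_star])
          · exact (norm_mul_le _ _).trans (by rw [norm_star])
      _ ≤ δ * M + (M + δ) * δ := by gcongr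
      _ ≤ 3 * M * δ := by nlinarith
  have f1 : ‖czPhi s p (star x * x) - ((n : ℂ) ^ k * σ) • (1 : O)‖ ≤ n ^ p * (3 * M * δ) := by
    rw [← k2, ← czPhi_sub]
    exact (czPhi_norm s hiso p _).trans (by gcongr)
  have f2 : ‖czPhi s p (star x * x) - (σ : ℂ) • (1 : O)‖ ≤ n ^ p * (3 * M * δ) := by
    rw [← k1, ← czPhi_sub, hx]
    exact (czPhi_norm s hiso p _).trans (by gcongr)
  have f3 : σ ≤ 2 * (n ^ p * (3 * M * δ)) := by
    have g : ‖((n : ℂ) ^ k * σ) • (1 : O) - (σ : ℂ) • (1 : O)‖ ≤ 2 * (n ^ p * (3 * M * δ)) := by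
      have e : ((n : ℂ) ^ k * σ) • (1 : O) - (σ : ℂ) • (1 : O)
        = (czPhi s p (star x * x) - (σ : ℂ) • (1 : O))
          - (czPhi s p (star x * x) - ((n : ℂ) ^ k * σ) • (1 : O)) := by abel
      rw [e]
      refine (norm_sub_le _ _).trans ?_
      linarith
    rw [← sub_smul, norm_smul, norm_one, mul_one] at g
    have e : ((n : ℂ) ^ k * σ - σ) = (((n : ℝ) ^ k * σ - σ : ℝ) : ℂ) := by push_cast; ring
    rw [e, Complex.norm_real, Real.norm_eq_abs] at g
    have h2 : (2 : ℝ) ≤ (n : ℝ) ^ k := by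
      have h2n : (2 : ℝ) ≤ n := by exact_mod_cast hn
      calc (2 : ℝ) ≤ n := h2n
        _ = n ^ 1 := (pow_one _).symm
        _ ≤ n ^ k := pow_le_pow_right₀ (by linarith) hk
    have := le_abs_self ((n : ℝ) ^ k * σ - σ)
    nlinarith
  have f4 : ‖czPhi s p (star x * x)‖ ≤ 3 * (n ^ p * (3 * M * δ)) := by
    have g := norm_sub_norm_le (czPhi s p (star x * x)) ((σ : ℂ) • (1 : O))
    rw [norm_smul, norm_one, mul_one, Complex.norm_real, Real.norm_of_nonneg hσ0] at g
    linarith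
  have f5 : ‖czPhi s (p + q) (star x * x)‖ ≤ n ^ q * (3 * (n ^ p * (3 * M * δ))) :=
    (czPhi_norm_add s hiso p q _).trans (by gcongr)
  have f6 := czPhi_lower s hiso q p κ _ hlow
  rw [add_comm q p] at f6
  have f7 : (n : ℝ) ^ p * κ ≤ ‖czPhi s (p + q) (star x * x)‖ := by
    have := CStarAlgebra.norm_le_norm_of_nonneg_of_le
      (smul_nonneg (by positivity) zero_le_one) f6
    rwa [norm_smul, norm_one, mul_one, Real.norm_of_nonneg (by positivity)] at this
  have f8 : δ ≤ κ / (n : ℝ) ^ q / (12 * M) := min_le_right _ _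
  rw [div_div, le_div_iff₀ (by positivity)] at f8
  have hnp : (0 : ℝ) < (n : ℝ) ^ p := by positivity
  have f9 : (n : ℝ) ^ p * κ ≤ (n : ℝ) ^ p * (9 * (δ * ((n : ℝ) ^ q * M))) := by
    refine (f7.trans f5).trans (le_of_eq ?_)
    ring
  have f10 := le_of_mul_le_mul_left f9 hnp
  nlinarith

include hsum in
lemma czW_le_succ (p q : ℕ) : czW s p q ≤ czW s (p + 1) (q + 1) := by
  unfold czW
  rw [Submodule.span_le]
  rintro _ ⟨⟨μ, ν⟩, rfl⟩
  have h : czS s p μ * star (czS s q ν)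
      = ∑ i, czS s (p + 1) (μ, i) * star (czS s (q + 1) (ν, i)) := by
    calc czS s p μ * star (czS s q ν)
        = czS s p μ * (∑ i, s i * star (s i)) * star (czS s q ν) := by rw [hsum, mul_one]
      _ = _ := by simp [czS, Finset.mul_sum, Finset.sum_mul, mul_assoc]
  simp only [h]
  refine Submodule.sum_mem _ fun i _ => Submodule.subset_span ⟨((μ, i), (ν, i)), rfl⟩

include hsum in
lemma czW_le_add (p q j : ℕ) : czW s p q ≤ czW s (p + j) (q + j) := by
  induction j with
  | zero => exact le_rfl
  | succ j ih => exact ih.trans (czW_le_succ s hsum _ _)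

include hiso in
lemma czW_mul (p q r : ℕ) : czW s p q * czW s q r ≤ czW s p r := by
  unfold czW
  rw [Submodule.span_mul_span, Submodule.span_le]
  rintro _ ⟨_, ⟨⟨μ, ν⟩, rfl⟩, _, ⟨⟨α, β⟩, rfl⟩, rfl⟩
  have h : (czS s p μ * star (czS s q ν)) * (czS s q α * star (czS s r β))
      = czS s p μ * (star (czS s q ν) * czS s q α) * star (czS s r β) := by
    simp [mul_assoc]
  simp only [h, czS_iso s hiso]
  split_ifs
  · rw [mul_one]; exact Submodule.subset_span ⟨(μ, β), rfl⟩
  · simp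

/-- The span of all words. -/
def czU : Submodule ℂ O := ⨆ pq : ℕ × ℕ, czW s pq.1 pq.2

lemma czW_le_U (p q : ℕ) : czW s p q ≤ czU s :=
  le_iSup (fun pq : ℕ × ℕ => czW s pq.1 pq.2) (p, q)

include hiso hsum in
lemma czU_mul : czU s * czU s ≤ czU s := by
  conv_lhs => unfold czU
  rw [Submodule.iSup_mul]
  refine iSup_le fun pq => ?_
  rw [Submodule.mul_iSup]
  refine iSup_le fun rt => ?_
  obtain ⟨p, q⟩ := pq
  obtain ⟨r, t⟩ := rt
  have h1 : czW s p q ≤ czW s (p + r) (q + r) := czW_le_add s hsum p q r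
  have h2 : czW s r t ≤ czW s (q + r) (t + q) := by
    rw [add_comm q r]; exact czW_le_add s hsum r t q
  exact ((mul_le_mul' h1 h2).trans (czW_mul s hiso _ _ _)).trans (czW_le_U s _ _)

lemma czU_star (x : O) (hx : x ∈ czU s) : star x ∈ czU s := by
  unfold czU at hx
  induction hx using Submodule.iSup_induction' with
  | mem pq x hx =>
    unfold czW at hx
    induction hx using Submodule.span_induction with
    | mem x hx =>
      obtain ⟨⟨μ, ν⟩, rfl⟩ := hx
      refine czW_le_U s pq.2 pq.1 (Submodule.subset_span ⟨(ν, μ), ?_⟩)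
      simp
    | zero => simp
    | add x y _ _ hx hy => rw [star_add]; exact add_mem hx hy
    | smul c x _ hx => rw [star_smul]; exact Submodule.smul_mem _ _ hx
  | zero => simp
  | add x y _ _ hx hy => rw [star_add]; exact add_mem hx hy

include hiso hsum in
lemma cz_adjoin_le (x : O) (hx : x ∈ StarAlgebra.adjoin ℂ (Set.range s)) : x ∈ czU s := by
  induction hx using StarAlgebra.adjoin_induction with
  | mem x hx =>
    obtain ⟨i, rfl⟩ := hx
    refine czW_le_U s 1 0 (Submodule.subset_span ⟨(((), i), ()), ?_⟩)
    simp [czS]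
  | algebraMap r =>
    rw [Algebra.algebraMap_eq_smul_one]
    refine Submodule.smul_mem _ _ (czW_le_U s 0 0 (Submodule.subset_span ⟨((), ()), ?_⟩))
    simp [czS]
  | add x y _ _ hx hy => exact add_mem hx hy
  | mul x y _ _ hx hy => exact czU_mul s hiso hsum (Submodule.mul_mem_mul hx hy)
  | star x _ hx => exact czU_star s x hx

lemma czW_exists_mat (p q : ℕ) (x : O) (hx : x ∈ czW s p q) :
    ∃ c : Matrix (CzIdx n p) (CzIdx n q) ℂ, czMat s c = x := by
  unfold czW at hx
  rw [Submodule.mem_span_range_iff_exists_fun] at hx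
  obtain ⟨c, hc⟩ := hx
  refine ⟨fun μ ν => c (μ, ν), ?_⟩
  rw [← hc, Fintype.sum_prod_type]
  rfl

section action

open MeasureTheory AddCircle

variable (ω : Circle → O ≃⋆ₐ[ℂ] O)
    (hω : ∀ u t : Circle, ∀ b : O, ω (u * t) b = ω u (ω t b))
    (hωcont : ∀ b : O, Continuous fun t : Circle => ω t b)
    (hgauge : ∀ (t : Circle) (i : Fin n), ω t (s i) = (t : ℂ) • s i)

include hgauge in
lemma czS_gauge (m : ℕ) (μ : CzIdx n m) (t : Circle) :
    ω t (czS s m μ) = ((t : ℂ) ^ m) • czS s m μ := by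
  induction m with
  | zero => simp [czS]
  | succ m ih =>
    simp only [czS, map_mul, ih, hgauge, smul_mul_smul_comm, pow_succ]

include hgauge in
lemma czW_gauge (p q : ℕ) (x : O) (hx : x ∈ czW s p q) (t : Circle) :
    ω t x = ((t : ℂ) ^ ((p : ℤ) - q)) • x := by
  unfold czW at hx
  induction hx using Submodule.span_induction with
  | mem x hx =>
    obtain ⟨⟨μ, ν⟩, rfl⟩ := hx
    simp only [map_mul, map_star, czS_gauge s ω hgauge, star_smul, smul_mul_smul_comm]
    congr 1
    rw [zpow_sub₀ (Circle.coe_ne_zero t), zpow_natCast, zpow_natCast, star_pow, div_eq_mul_inv,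
      ← inv_pow, ← Circle.coe_inv, Circle.coe_inv_eq_conj]
    rfl
  | zero => simp
  | add x y _ _ hx hy => rw [map_add, hx, hy, smul_add]
  | smul c x _ hx => rw [map_smul, hx, smul_comm]

/-- Orbit map on the additive circle. -/
def czOrb (b : O) (θ : UnitAddCircle) : O := ω (toCircle θ) b

include hωcont in
lemma czOrb_cont (b : O) : Continuous (czOrb ω b) := (hωcont b).comp continuous_toCircle

include hωcont in
lemma czOrb_int (b : O) : Integrable (czOrb ω b) haarAddCircle :=
  (czOrb_cont ω hωcont b).integrable_of_hasCompactSupport (HasCompactSupport.of_compactSpace _)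

/-- Spectral component. -/
def czE (k : ℤ) (b : O) : O := fourierCoeff (czOrb ω b) k

include hωcont in
lemma czE_add (k : ℤ) (a b : O) : czE ω k (a + b) = czE ω k a + czE ω k b := by
  unfold czE
  rw [← Pi.add_apply, ← fourierCoeff.add (czOrb_int ω hωcont a) (czOrb_int ω hωcont b)]
  congr 1
  ext θ
  simp [czOrb]

lemma czE_smul (k : ℤ) (c : ℂ) (a : O) : czE ω k (c • a) = c • czE ω k a := by
  unfold czE
  rw [← fourierCoeff.const_smul]
  congr 1
  ext θ
  simp [czOrb]

lemma cz_omega_norm (t : Circle) (b : O) : ‖ω t b‖ = ‖b‖ := StarAlgEquiv.norm_map (ω t) b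

lemma czE_norm (k : ℤ) (b : O) : ‖czE ω k b‖ ≤ ‖b‖ := by
  unfold czE fourierCoeff
  refine (norm_integral_le_of_norm_le_const (C := ‖b‖) (ae_of_all _ fun θ => ?_)).trans ?_
  · rw [norm_smul, czOrb, cz_omega_norm, fourier_apply, Circle.norm_coe, one_mul]
  · simp

lemma cz_fourier_eq (j : ℤ) (θ : UnitAddCircle) : fourier j θ = ((toCircle θ : Circle) : ℂ) ^ j := by
  rw [fourier_apply, toCircle_zsmul, Circle.coe_zpow]

lemma czE_graded (j k : ℤ) (b : O) (hb : ∀ t : Circle, ω t b = ((t : ℂ) ^ j) • b) :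
    czE ω k b = if j = k then b else 0 := by
  have h : czOrb ω b = fun θ => (fourier j θ : ℂ) • b := by
    ext θ; rw [czOrb, hb, cz_fourier_eq]
  have h2 : czE ω k b = (fourierCoeff (fourier (T := 1) j) k) • b := by
    unfold czE fourierCoeff
    rw [h, ← integral_smul_const]
    simp [smul_smul]
  rw [h2, fourierCoeff_fourier]
  by_cases hjk : j = k
  · subst hjk; simp
  · simp [hjk, Ne.symm hjk]

include hω hωcont in
lemma czE_gauge (k : ℤ) (b : O) (t : Circle) : ω t (czE ω k b) = ((t : ℂ) ^ k) • czE ω k b := by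
  obtain ⟨φ, rfl⟩ : ∃ φ : UnitAddCircle, toCircle φ = t := by
    obtain ⟨φ, h⟩ := (homeomorphCircle (T := 1) one_ne_zero).surjective t
    exact ⟨φ, by rw [← h, homeomorphCircle_apply]⟩
  let L : O →L[ℂ] O :=
    ⟨{ toFun := ω (toCircle φ), map_add' := map_add _, map_smul' := fun c x => map_smul _ c x },
      (AddMonoidHomClass.isometry_of_norm (ω (toCircle φ))
        (fun x => cz_omega_norm ω _ x)).continuous⟩
  have hInteg : Integrable (fun θ => fourier (-k) θ • czOrb ω b θ) haarAddCircle :=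
    (czOrb_int ω hωcont b).fourier_smul (-k)
  have h1 : ω (toCircle φ) (czE ω k b)
      = ∫ θ : UnitAddCircle, L (fourier (-k) θ • czOrb ω b θ) ∂haarAddCircle := by
    rw [L.integral_comp_comm hInteg]; rfl
  have h2 : ∀ θ : UnitAddCircle, L (fourier (-k) θ • czOrb ω b θ)
      = ((toCircle φ : ℂ) ^ k) • (fourier (-k) (φ + θ) • czOrb ω b (φ + θ)) := by
    intro θ
    change ω (toCircle φ) _ = _
    rw [map_smul, czOrb, ← hω, ← toCircle_add, ← czOrb, smul_smul]
    congr 1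
    rw [cz_fourier_eq, cz_fourier_eq, toCircle_add, Circle.coe_mul, mul_zpow, ← mul_assoc,
      ← zpow_add₀ (Circle.coe_ne_zero _), add_neg_cancel, zpow_zero, one_mul]
  rw [h1]
  simp only [h2]
  rw [integral_smul, integral_add_left_eq_self
    (fun θ : UnitAddCircle => fourier (-k) θ • czOrb ω b θ) φ]
  rfl

include hωcont in
lemma czE_commute (k : ℤ) (b z : O) (h : ∀ t, ω t b * z = z * ω t b) :
    czE ω k b * z = z * czE ω k b := by
  have hInteg : Integrable (fun θ => fourier (-k) θ • czOrb ω b θ) haarAddCircle :=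
    (czOrb_int ω hωcont b).fourier_smul (-k)
  unfold czE fourierCoeff
  rw [← integral_mul_const_of_integrable hInteg, ← integral_const_mul_of_integrable hInteg]
  congr 1
  ext θ
  rw [smul_mul_assoc, mul_smul_comm, czOrb, h]

include hiso hsum hωcont hgauge in
lemma czE_U (k : ℕ) (x : O) (hx : x ∈ czU s) : ∃ q, czE ω k x ∈ czW s (q + k) q := by
  let E : O →ₗ[ℂ] O :=
    { toFun := czE ω k, map_add' := czE_add ω hωcont k, map_smul' := czE_smul ω k }
  let F : ℕ →o Submodule ℂ O :=
    { toFun := fun q => czW s (q + k) q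
      monotone' := monotone_nat_of_le_succ fun q => by
        have := czW_le_succ s hsum (q + k) q
        rwa [show q + k + 1 = q + 1 + k by ring] at this }
  have key : czU s ≤ (⨆ q, F q).comap E := by
    unfold czU
    refine iSup_le fun pq y hy => ?_
    obtain ⟨p, q⟩ := pq
    have h := czE_graded ω _ k y (czW_gauge s ω hgauge p q y hy)
    change czE ω k y ∈ ⨆ q, F q
    rw [h]
    split_ifs with hpq
    · have : p = q + k := by omega
      subst this
      exact Submodule.mem_iSup_of_mem (p := F) q hy
    · exact zero_mem _
  exact (Submodule.mem_iSup_of_chain F _).mp (key hx)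

include hiso hsum hωcont hgauge in
lemma cz_approx (hgen : (StarAlgebra.adjoin ℂ (Set.range s)).topologicalClosure = ⊤)
    (k : ℕ) (x : O) (hx : ∀ t : Circle, ω t x = ((t : ℂ) ^ (k : ℤ)) • x) (ε : ℝ) (hε : 0 < ε) :
    ∃ q, ∃ c : Matrix (CzIdx n (q + k)) (CzIdx n q) ℂ, ‖x - czMat s c‖ ≤ ε := by
  have hmem : x ∈ closure (StarAlgebra.adjoin ℂ (Set.range s) : Set O) := by
    rw [← StarSubalgebra.topologicalClosure_coe, hgen]; trivial
  obtain ⟨y, hy, hxy⟩ := Metric.mem_closure_iff.mp hmem ε hε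
  obtain ⟨q, hq⟩ := czE_U s hiso hsum ω hωcont hgauge k y (cz_adjoin_le s hiso hsum y hy)
  obtain ⟨c, hc⟩ := czW_exists_mat s _ _ _ hq
  refine ⟨q, c, ?_⟩
  have h1 : czE ω k x = x := by rw [czE_graded ω k k x hx, if_pos rfl]
  have h2 : x - czE ω k y = czE ω k (x - y) := by
    have := czE_add ω hωcont k (x - y) y
    rw [sub_add_cancel, h1] at this
    rw [eq_sub_of_add_eq this.symm]
  rw [hc, h2]
  refine (czE_norm ω k _).trans ?_
  rw [← dist_eq_norm]
  exact hxy.le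

include hω in
lemma cz_omega_one (b : O) : ω 1 b = b := by
  have := hω 1 1 b
  rw [mul_one] at this
  exact ((ω 1).injective this).symm

include hω hωcont in
lemma cz_fixed (a : O) (h : ∀ k : ℤ, k ≠ 0 → czE ω k a = 0) (t : Circle) : ω t a = a := by
  have key : ∀ θ : UnitAddCircle, czOrb ω a θ = czE ω 0 a := by
    intro θ
    rw [SeparatingDual.eq_iff_forall_dual_eq (R := ℂ)]
    intro ℓ
    let g : C(UnitAddCircle, ℂ) := ⟨fun θ => ℓ (czOrb ω a θ),
      ℓ.continuous.comp (czOrb_cont ω hωcont a)⟩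
    have hg : ∀ k, fourierCoeff g k = ℓ (czE ω k a) := by
      intro k
      have hInteg : Integrable (fun θ => fourier (-k) θ • czOrb ω a θ) haarAddCircle :=
        (czOrb_int ω hωcont a).fourier_smul (-k)
      unfold czE fourierCoeff
      rw [← ℓ.integral_comp_comm hInteg]
      simp [g]
    have hz : ∀ k, k ∉ ({0} : Finset ℤ) → fourierCoeff g k = 0 := by
      intro k hk
      rw [hg, h k (by simpa using hk), map_zero]
    have hs : Summable (fourierCoeff g) := summable_of_ne_finset_zero hz
    have h1 := has_pointwise_sum_fourier_series_of_summable hs θ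
    have h2 := hasSum_sum_of_ne_finset_zero (L := SummationFilter.unconditional ℤ)
      (f := fun i => fourierCoeff g i • fourier i θ)
      (s := {0}) (fun k hk => by simp [hz k hk])
    have h3 := h1.unique h2
    simp only [Finset.sum_singleton, fourier_zero, smul_eq_mul, mul_one, hg] at h3
    exact h3
  obtain ⟨φ, rfl⟩ : ∃ φ : UnitAddCircle, toCircle φ = t := by
    obtain ⟨φ, h⟩ := (homeomorphCircle (T := 1) one_ne_zero).surjective t
    exact ⟨φ, by rw [← h, homeomorphCircle_apply]⟩
  have h0 := key 0
  rw [czOrb, toCircle_zero, cz_omega_one ω hω] at h0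
  exact (key φ).trans h0.symm

end action

end

/-- In the Cuntz algebra `𝒪ₙ` (`n ≥ 2`), presented as a C*-algebra generated by
isometries `s i` with `sᵢ* sⱼ = δ_{ij}` and `Σ sᵢ sᵢ* = 1`, with gauge circle
action `ω_t(sᵢ) = t sᵢ`: any subalgebra `A` maximal among abelian
`𝕋`-invariant *-subalgebras is contained in the fixed-point algebra `𝒪ₙ⁰`. -/
theorem cuntz_maximal_invariant_abelian_subset_fixed
    {O : Type*} [CStarAlgebra O] (n : ℕ) (hn : 2 ≤ n) (s : Fin n → O)
    (hiso : ∀ i j : Fin n, star (s i) * s j = if i = j then (1 : O) else 0)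
    (hsum : ∑ i : Fin n, s i * star (s i) = (1 : O))
    (hgen : (StarAlgebra.adjoin ℂ (Set.range s)).topologicalClosure = ⊤)
    (ω : Circle → O ≃⋆ₐ[ℂ] O)
    (hω : ∀ u t : Circle, ∀ b : O, ω (u * t) b = ω u (ω t b))
    (hωcont : ∀ b : O, Continuous fun t : Circle => ω t b)
    (hgauge : ∀ (t : Circle) (i : Fin n), ω t (s i) = (t : ℂ) • s i)
    (A : StarSubalgebra ℂ O)
    (hab : ∀ a ∈ A, ∀ a' ∈ A, a * a' = a' * a)
    (hA : ∀ t : Circle, ∀ a ∈ A, ω t a ∈ A)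
    (hmax : ∀ A' : StarSubalgebra ℂ O,
      (∀ a ∈ A', ∀ a' ∈ A', a * a' = a' * a) →
      (∀ t : Circle, ∀ a ∈ A', ω t a ∈ A') → A ≤ A' → A' = A) :
    ∀ a ∈ A, ∀ t : Circle, ω t a = a := by
  intro a ha t
  refine cz_fixed ω hω hωcont a (fun k hk => ?_) t
  have hcomm : ∀ b ∈ A, czE ω k a * b = b * czE ω k a := fun b hb =>
    czE_commute ω hωcont k a b fun t => hab _ (hA t a ha) _ hb
  have hcomm' : ∀ b ∈ A, b * star (czE ω k a) = star (czE ω k a) * b := by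
    intro b hb
    have := congrArg star (hcomm (star b) (star_mem hb))
    simpa using this
  have hnormal : czE ω k a * star (czE ω k a) = star (czE ω k a) * czE ω k a :=
    czE_commute ω hωcont k a _ fun t => hcomm' _ (hA t a ha)
  have hgr := czE_gauge ω hω hωcont k a
  rcases lt_or_gt_of_ne hk with hneg | hpos
  · obtain ⟨m, hm⟩ : ∃ m : ℕ, k = -(m : ℤ) := ⟨(-k).toNat, by omega⟩
    have hz : star (czE ω k a) = 0 := by
      refine cz_normal_zero s hn hiso hsum m (by omega) _ (by rw [star_star, hnormal]) ?_
      refine cz_approx s hiso hsum ω hωcont hgauge hgen m _ fun t => ?_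
      rw [map_star, hgr, star_smul, hm, star_zpow₀, zpow_neg, ← inv_zpow]
      congr 2
      rw [show star (t : ℂ) = ((t⁻¹ : Circle) : ℂ) from (Circle.coe_inv_eq_conj t).symm,
        Circle.coe_inv, inv_inv]
    exact star_eq_zero.mp hz
  · obtain ⟨m, hm⟩ : ∃ m : ℕ, k = (m : ℤ) := ⟨k.toNat, by omega⟩
    refine cz_normal_zero s hn hiso hsum m (by omega) _ hnormal.symm ?_
    exact cz_approx s hiso hsum ω hωcont hgauge hgen m _ fun t => by rw [hgr, hm]
end
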